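/- Any projective module over a commutative local ring is free. -/

import Mathlib

open Submodule in
/-- An element admitting a finite dual representation lies in a finite free direct summand. -/
theorem kap_local {R Q : Type*} [CommRing R] [IsLocalRing R] [AddCommGroup Q] [Module R Q] (x : Q) :
    ∀ (n : ℕ) (φ : Fin n → (Q →ₗ[R] R)) (y : Fin n → Q), x = ∑ i, φ i x • y i →
    ∃ (k : ℕ) (y' : Fin k → Q) (Φ : Q →ₗ[R] (Fin k → R)),
      (∀ j, Φ (y' j) = Pi.single j 1) ∧ x ∈ span R (Set.range y') := by
  intro n
  induction n with
  | zero =>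
    intro φ y h
    refine ⟨0, y, 0, fun j => j.elim0, ?_⟩
    rw [h]; simp
  | succ n ih =>
    intro φ y h
    let D : Matrix (Fin (n+1)) (Fin (n+1)) R := fun i j => (if i = j then 1 else 0) - φ j (y i)
    have hD : ∀ j, ∑ k, φ k x * D k j = 0 := by
      intro j
      have h2 : φ j x = ∑ k, φ k x * φ j (y k) := by
        conv_lhs => rw [h]
        simp
      simp only [D, mul_sub, Finset.sum_sub_distrib]
      rw [← h2]; simp
    by_cases hu : ∃ i j, IsUnit (D i j)
    · obtain ⟨i, j, u, hu⟩ := hu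
      have h3 := hD j
      rw [Fin.sum_univ_succAbove _ i, ← hu] at h3
      have h4 : φ i x = ∑ k : Fin n, φ (i.succAbove k) x * (-(↑u⁻¹ * D (i.succAbove k) j)) := by
        have : φ i x = (φ i x * u) * ↑u⁻¹ := by simp [mul_assoc]
        rw [this, eq_neg_of_add_eq_zero_left h3, ← Finset.sum_neg_distrib, Finset.sum_mul]
        refine Finset.sum_congr rfl fun k _ => by ring
      refine ih (fun k => φ (i.succAbove k))
        (fun k => y (i.succAbove k) + (-(↑u⁻¹ * D (i.succAbove k) j)) • y i) ?_
      conv_lhs => rw [h, Fin.sum_univ_succAbove _ i, h4]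
      simp only [smul_add, Finset.sum_add_distrib, Finset.sum_smul, smul_smul]
      rw [add_comm]
    · push Not at hu
      let C : Matrix (Fin (n+1)) (Fin (n+1)) R := Matrix.of fun j i => φ j (y i)
      have hCa : ∀ j i, C j i = φ j (y i) := fun _ _ => rfl
      have hC : IsUnit C.det := by
        rw [← IsLocalRing.residue_ne_zero_iff_isUnit, RingHom.map_det]
        have : (IsLocalRing.residue R).mapMatrix C = 1 := by
          ext j i
          have h5 : IsLocalRing.residue R (D i j) = 0 := by
            rw [IsLocalRing.residue_eq_zero_iff]
            exact hu i j
          simp only [D, map_sub, sub_eq_zero] at h5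
          simp only [RingHom.mapMatrix_apply, Matrix.map_apply, hCa, Matrix.one_apply]
          rw [← h5]
          by_cases hij : i = j
          · simp [hij]
          · simp [hij, Ne.symm hij]
        rw [this]; simp
      refine ⟨n+1, y, (Matrix.toLin' C⁻¹) ∘ₗ LinearMap.pi φ, ?_, ?_⟩
      · intro j
        have : (LinearMap.pi φ) (y j) = C.mulVec (Pi.single j 1) := by
          ext k; simp [hCa]
        rw [LinearMap.comp_apply, this, Matrix.toLin'_apply, Matrix.mulVec_mulVec,
          Matrix.nonsing_inv_mul _ hC, Matrix.one_mulVec]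
      · rw [h]
        exact sum_mem fun i _ => smul_mem _ _ (subset_span ⟨i, rfl⟩)

/-- Every element of a projective module over a local ring lies in a finite free summand. -/
theorem kap_local' {R Q : Type*} [CommRing R] [IsLocalRing R] [AddCommGroup Q] [Module R Q]
    [Module.Projective R Q] (x : Q) :
    ∃ (k : ℕ) (y' : Fin k → Q) (Φ : Q →ₗ[R] (Fin k → R)),
      (∀ j, Φ (y' j) = Pi.single j 1) ∧ x ∈ Submodule.span R (Set.range y') := by
  obtain ⟨s, hs⟩ := (Module.projective_def' (R := R) (P := Q)).1 inferInstance
  let e := (s x).support.equivFin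
  refine kap_local x _ (fun i => Finsupp.lapply ((e.symm i : Q)) ∘ₗ s) (fun i => (e.symm i : Q)) ?_
  have h := LinearMap.congr_fun hs x
  simp only [LinearMap.comp_apply, LinearMap.id_apply, Finsupp.linearCombination_apply,
    Finsupp.sum] at h
  conv_lhs => rw [← h]
  rw [← Finset.sum_coe_sort, ← e.symm.sum_comp]
  rfl

/-- A linearly independent set spanning a direct summand. -/
def KapSplit (R : Type*) {M : Type*} [CommRing R] [AddCommGroup M] [Module R M] (B : Set M) : Prop :=
  LinearIndepOn R id B ∧ ∃ ρ : M →ₗ[R] M, (∀ m, ρ m ∈ Submodule.span R B) ∧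
    ∀ b ∈ Submodule.span R B, ρ b = b

section
variable {R M : Type*} [CommRing R] [IsLocalRing R] [AddCommGroup M] [Module R M]
  [Module.Projective R M]

open Submodule

theorem kap_step (B : Set M) (hB : KapSplit R B) (x : M) :
    ∃ D : Set M, D.Finite ∧ KapSplit R (B ∪ D) ∧ x ∈ span R (B ∪ D) := by
  obtain ⟨hli, ρ, hρ, hρ'⟩ := hB
  let q : M →ₗ[R] LinearMap.ker ρ := LinearMap.codRestrict _ (LinearMap.id - ρ) (by
    intro m; simp [hρ' _ (hρ m)])
  have hq : ∀ z : LinearMap.ker ρ, q z = z := by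
    intro z; ext; simp [q]
  have hqc : ∀ m, (q m : M) = m - ρ m := fun m => by simp [q]
  have : Module.Projective R (LinearMap.ker ρ) :=
    Module.Projective.of_split (LinearMap.ker ρ).subtype q (by ext z; simp [hq])
  obtain ⟨k, y, Φ, hΦ, hx⟩ := kap_local' (R := R) (q x)
  let y' : Fin k → M := fun i => (y i : M)
  have hspan : span R (Set.range y') = (span R (Set.range y)).map (LinearMap.ker ρ).subtype := by
    rw [Submodule.map_span, ← Set.range_comp]; rfl
  have hxy : x - ρ x ∈ span R (Set.range y') := by
    rw [hspan, ← hqc]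
    exact ⟨_, hx, rfl⟩
  have hle : span R (Set.range y') ≤ LinearMap.ker ρ := by
    rw [span_le]; rintro _ ⟨i, rfl⟩; exact (y i).2
  have hyli : LinearIndependent R y' := by
    have h1 : LinearIndependent R ((Φ ∘ₗ q) ∘ y') := by
      have : ((Φ ∘ₗ q) ∘ y') = fun j => Pi.single j (1 : R) := by
        funext j
        simp [y', hq, hΦ]
      rw [this]
      exact Pi.linearIndependent_single_one _ _
    exact LinearIndependent.of_comp (Φ ∘ₗ q) h1
  let Y : (Fin k → R) →ₗ[R] M := Fintype.linearCombination R y'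
  have hY : ∀ v, Y v ∈ span R (Set.range y') := by
    intro v
    simp only [Y, Fintype.linearCombination_apply]
    exact sum_mem fun i _ => smul_mem _ _ (subset_span ⟨i, rfl⟩)
  refine ⟨Set.range y', Set.finite_range _, ⟨?_, ρ + Y ∘ₗ Φ ∘ₗ q, ?_, ?_⟩, ?_⟩
  · refine LinearIndepOn.id_union hli hyli.linearIndepOn_id ?_
    rw [Submodule.disjoint_def]
    intro z hz hz'
    rw [← hρ' z hz]; exact hle hz'
  · intro m
    rw [span_union]
    exact Submodule.add_mem_sup (hρ m) (hY _)
  · intro b hb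
    have : span R (B ∪ Set.range y') ≤ LinearMap.eqLocus (ρ + Y ∘ₗ Φ ∘ₗ q) LinearMap.id := by
      rw [span_le]
      rintro z (hz | ⟨j, rfl⟩)
      · have h1 := hρ' z (subset_span hz)
        have h2 : q z = 0 := by ext; simp [hqc, h1]
        simp [h1, h2]
      · have h1 : ρ (y' j) = 0 := (y j).2
        have h2 : q (y' j) = y j := hq _
        simp [h1, h2, hΦ, Y]
    exact this hb
  · rw [span_union, ← add_sub_cancel (ρ x) x]
    exact Submodule.add_mem_sup (hρ x) hxy

theorem kap_step_finite (B : Set M) (hB : KapSplit R B) (X : Set M) (hX : X.Finite) :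
    ∃ D : Set M, D.Finite ∧ KapSplit R (B ∪ D) ∧ X ⊆ span R (B ∪ D) := by
  induction X, hX using Set.Finite.induction_on with
  | empty => exact ⟨∅, Set.finite_empty, by simpa using hB, by simp⟩
  | @insert a X _ _ ih =>
    obtain ⟨D, hD, hs, hX⟩ := ih
    obtain ⟨D', hD', hs', ha⟩ := kap_step _ hs a
    refine ⟨D ∪ D', hD.union hD', by rwa [← Set.union_assoc], ?_⟩
    rw [← Set.union_assoc, Set.insert_subset_iff]
    exact ⟨ha, hX.trans (span_mono Set.subset_union_left)⟩

/-- Good pairs. -/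
def KapGood (s : M →ₗ[R] (M →₀ R)) (x : Set M × Set M) : Prop :=
  LinearIndepOn R id x.1 ∧ span R x.1 = span R x.2 ∧
    ∀ m ∈ span R x.2, s m ∈ Finsupp.supported R R x.2

/-- Invariant for the countable construction. -/
def KapInv (s : M →ₗ[R] (M →₀ R)) (x : Set M × Set M × Set M) : Prop :=
  KapSplit R x.1 ∧ x.2.2.Finite ∧ x.2.1 ⊆ span R x.1 ∧
    ∀ b ∈ x.1, b ∉ x.2.2 → s b ∈ Finsupp.supported R R x.2.1

theorem kap_inv_step (s : M →ₗ[R] (M →₀ R)) (i : M) (x : Set M × Set M × Set M)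
    (hx : KapInv s x) : ∃ x' : Set M × Set M × Set M, KapInv s x' ∧ x.1 ⊆ x'.1 ∧ x.2.1 ⊆ x'.2.1 ∧
      i ∈ x'.2.1 ∧ ∀ b ∈ x.1, s b ∈ Finsupp.supported R R x'.2.1 := by
  obtain ⟨B, S, D⟩ := x
  obtain ⟨h1, h2, h3, h4⟩ := hx
  simp only at h1 h2 h3 h4
  let U : Set M := insert i (⋃ d ∈ D, ((s d).support : Set M))
  have hU : U.Finite := (h2.biUnion fun d _ => Finset.finite_toSet _).insert i
  obtain ⟨D', hD', hs', hUs⟩ := kap_step_finite B h1 U hU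
  have h5 : ∀ b ∈ B, s b ∈ Finsupp.supported R R (S ∪ U) := by
    intro b hb
    by_cases hbD : b ∈ D
    · rw [Finsupp.mem_supported]
      intro t ht
      exact Or.inr (Or.inr (Set.mem_biUnion hbD ht))
    · exact Finsupp.supported_mono Set.subset_union_left (h4 b hb hbD)
  refine ⟨(B ∪ D', S ∪ U, D'), ⟨hs', hD', ?_, ?_⟩, Set.subset_union_left, Set.subset_union_left,
    Or.inr (Or.inl rfl), h5⟩
  · exact Set.union_subset (h3.trans (span_mono Set.subset_union_left)) hUs
  · rintro b (hb | hb) hb'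
    · exact h5 b hb
    · exact absurd hb hb'

theorem kap_extend (s : M →ₗ[R] (M →₀ R)) (hs : ∀ m, Finsupp.linearCombination R id (s m) = m)
    (x : Set M × Set M) (hx : KapGood s x) (i : M) :
    ∃ x', KapGood s x' ∧ x ≤ x' ∧ i ∈ x'.2 := by
  classical
  obtain ⟨B, S⟩ := x
  obtain ⟨h1, h2, h3⟩ := hx
  simp only at h1 h2 h3
  have hlc : ∀ (T : Set M) (m : M), s m ∈ Finsupp.supported R R T → m ∈ span R T := by
    intro T m hm
    rw [← hs m, ← Set.image_id T]
    exact (Finsupp.mem_span_image_iff_linearCombination R).2 ⟨_, hm, rfl⟩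
  have h0 : KapInv s (B, S, ∅) := by
    refine ⟨⟨h1, ?_⟩, Set.finite_empty, ?_, ?_⟩
    · refine ⟨Finsupp.linearCombination R id ∘ₗ (Finsupp.supported R R S).subtype ∘ₗ
        Finsupp.restrictDom R R S ∘ₗ s, ?_, ?_⟩
      · intro m
        change _ ∈ span R B
        rw [h2]
        have key : ∀ v ∈ Finsupp.supported R R S,
            Finsupp.linearCombination R id v ∈ span R S := by
          intro v hv
          rw [← Set.image_id S]
          exact (Finsupp.mem_span_image_iff_linearCombination R).2 ⟨v, hv, rfl⟩
        exact key _ (Finsupp.restrictDom R R S (s m)).2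
      · intro b hb
        have hb' := h3 b (h2 ▸ hb)
        have : (Finsupp.restrictDom R R S (s b) : M →₀ R) = s b := by
          rw [Finsupp.restrictDom_apply]
          exact Finsupp.filter_eq_self_iff _ _ |>.2 fun t ht => hb' (by simpa using ht)
        simp only [LinearMap.comp_apply, Submodule.subtype_apply, this, hs]
    · simp only; rw [h2]; exact subset_span
    · intro b hb _
      exact h3 b (h2 ▸ subset_span hb)
  choose! f hf using fun x hx => kap_inv_step s i x hx
  let g : ℕ → Set M × Set M × Set M := fun n => f^[n] (B, S, ∅)
  have hg : ∀ n, g (n+1) = f (g n) := fun n => Function.iterate_succ_apply' f n _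
  have hinv : ∀ n, KapInv s (g n) := by
    intro n
    induction n with
    | zero => exact h0
    | succ n ih => rw [hg]; exact (hf _ ih).1
  have mB : Monotone fun n => (g n).1 := monotone_nat_of_le_succ fun n => by
    rw [hg]; exact (hf _ (hinv n)).2.1
  have mS : Monotone fun n => (g n).2.1 := monotone_nat_of_le_succ fun n => by
    rw [hg]; exact (hf _ (hinv n)).2.2.1
  have hb : ∀ b ∈ ⋃ n, (g n).1, s b ∈ Finsupp.supported R R (⋃ n, (g n).2.1) := by
    intro b hb
    obtain ⟨n, hn⟩ := Set.mem_iUnion.1 hb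
    have := (hf _ (hinv n)).2.2.2.2 b hn
    rw [← hg] at this
    exact Finsupp.supported_mono (Set.subset_iUnion (fun n => (g n).2.1) (n+1)) this
  have hsp : span R (⋃ n, (g n).1) = span R (⋃ n, (g n).2.1) := by
    apply le_antisymm
    · rw [span_le]
      exact fun b hb' => hlc _ b (hb b hb')
    · rw [span_le]
      refine Set.iUnion_subset fun n => (hinv n).2.2.1.trans ?_
      exact span_mono (Set.subset_iUnion (fun n => (g n).1) n)
  refine ⟨(⋃ n, (g n).1, ⋃ n, (g n).2.1), ⟨?_, hsp, ?_⟩, ⟨?_, ?_⟩, ?_⟩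
  · exact linearIndepOn_iUnion_of_directed mB.directed_le fun n => (hinv n).1.1
  · simp only
    rw [← hsp]
    have : span R (⋃ n, (g n).1) ≤ (Finsupp.supported R R (⋃ n, (g n).2.1)).comap s :=
      span_le.2 hb
    exact fun m hm => this hm
  · exact Set.subset_iUnion (fun n => (g n).1) 0
  · exact Set.subset_iUnion (fun n => (g n).2.1) 0
  · refine Set.mem_iUnion.2 ⟨1, ?_⟩
    have := (hf _ (hinv 0)).2.2.2.1
    rwa [← hg] at this

end

/-- Any projective module over a commutative local ring is free. -/
theorem projective_over_local_ring_is_free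
    {R M : Type*} [CommRing R] [IsLocalRing R]
    [AddCommGroup M] [Module R M] [Module.Projective R M] :
    Module.Free R M := by
  obtain ⟨s, hs⟩ := (Module.projective_def' (R := R) (P := M)).1 inferInstance
  have hs' : ∀ m, Finsupp.linearCombination R id (s m) = m := fun m => LinearMap.congr_fun hs m
  have hz : ∀ c ⊆ {x | KapGood s x}, IsChain (· ≤ ·) c →
      ∃ ub ∈ {x | KapGood s x}, ∀ z ∈ c, z ≤ ub := by
    intro c hc hch
    refine ⟨(⋃ x : c, x.1.1, ⋃ x : c, x.1.2), ⟨?_, ?_, ?_⟩, ?_⟩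
    · refine linearIndepOn_iUnion_of_directed ?_ fun x => (hc x.2).1
      intro a b
      rcases hch.total a.2 b.2 with h | h
      · exact ⟨b, h.1, le_rfl⟩
      · exact ⟨a, le_rfl, h.1⟩
    · simp only [Submodule.span_iUnion]
      exact iSup_congr fun x => (hc x.2).2.1
    · have : Submodule.span R (⋃ x : c, x.1.2) ≤
          (Finsupp.supported R R (⋃ x : c, x.1.2)).comap s := by
        rw [Submodule.span_le]
        refine Set.iUnion_subset fun x m hm => ?_
        exact Finsupp.supported_mono (Set.subset_iUnion (fun x : c => x.1.2) x)
          ((hc x.2).2.2 m (Submodule.subset_span hm))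
      exact fun m hm => this hm
    · intro z hz
      exact ⟨Set.subset_iUnion (fun x : c => x.1.1) ⟨z, hz⟩,
        Set.subset_iUnion (fun x : c => x.1.2) ⟨z, hz⟩⟩
  obtain ⟨x, hx⟩ := zorn_le₀ _ hz
  have huniv : ∀ i, i ∈ x.2 := by
    intro i
    obtain ⟨x', h1, h2, h3⟩ := kap_extend s hs' x hx.prop i
    exact (hx.le_of_ge h1 h2).2 h3
  have htop : Submodule.span R x.1 = ⊤ := by
    rw [hx.prop.2.1, Set.eq_univ_of_forall huniv, Submodule.span_univ]
  exact Module.Free.of_basis (Module.Basis.mk (v := fun b : x.1 => (b : M)) hx.prop.1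
    (by rw [Subtype.range_coe, htop]))
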